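/- arXiv:2510.03924 — 2 statements merged into one kernel-verified Lean document; each statement's English description precedes it below -/
import Mathlib

section
/- Let H_7 be the graph on vertices {1,…,7} with edges {12, 13, 14, 23, 25, 36, 47, 57, 67}. The adjacency matrix of H_7 has exactly 4 positive eigenvalues and 3 negative eigenvalues. -/
/-- The edge relation of the graph `H₇` on vertices `{1,…,7}` (represented by `Fin 7`
with vertex `k` corresponding to index `k - 1`), with edges
`{12, 13, 14, 23, 25, 36, 47, 57, 67}`. -/
def H7Edge (i j : Fin 7) : Prop :=
  (i.val + 1, j.val + 1) ∈ [(1,2),(1,3),(1,4),(2,3),(2,5),(3,6),(4,7),(5,7),(6,7)] ∨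
  (j.val + 1, i.val + 1) ∈ [(1,2),(1,3),(1,4),(2,3),(2,5),(3,6),(4,7),(5,7),(6,7)]

instance : DecidableRel H7Edge := fun _ _ => by unfold H7Edge; infer_instance

set_option maxHeartbeats 4000000 in
theorem H7_det {R : Type*} [CommRing R] (x : R) : Matrix.det !![x,-1,-1,-1,0,0,0;-1,x,-1,0,-1,0,0;-1,-1,x,0,0,-1,0;-1,0,0,x,0,0,-1;0,-1,0,0,x,0,-1;0,0,-1,0,0,x,-1;0,0,0,-1,-1,-1,x] = (x^3-2*x^2-4*x+6)*(x^2+x-1)^2 := by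
  simp [Matrix.det_succ_row_zero, Fin.sum_univ_succ, Fin.succAbove]
  ring

open Polynomial in
theorem H7_cp (A : Matrix (Fin 7) (Fin 7) ℝ)
    (hdef : ∀ i j : Fin 7, A i j = if H7Edge i j then 1 else 0) :
    A.charpoly = (X^3-2*X^2-4*X+6)*(X^2+X-1)^2 := by
  have h : A = !![0,1,1,1,0,0,0;1,0,1,0,1,0,0;1,1,0,0,0,1,0;1,0,0,0,0,0,1;0,1,0,0,0,0,1;0,0,1,0,0,0,1;0,0,0,1,1,1,0] := by
    ext i j
    rw [hdef]
    fin_cases i <;> fin_cases j <;> simp [H7Edge]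
  have h2 : A.charmatrix = !![X,-1,-1,-1,0,0,0;-1,X,-1,0,-1,0,0;-1,-1,X,0,0,-1,0;-1,0,0,X,0,0,-1;0,-1,0,0,X,0,-1;0,0,-1,0,0,X,-1;0,0,0,-1,-1,-1,X] := by
    rw [h]
    ext1 i j
    fin_cases i <;> fin_cases j <;> simp [Matrix.charmatrix_apply, Matrix.diagonal]
  rw [Matrix.charpoly, h2, H7_det]

theorem H7_cubic : ∃ a b c : ℝ, a < 0 ∧ 0 < b ∧ 0 < c ∧ a+b+c = 2 ∧ a*b+b*c+c*a = -4 ∧ a*b*c = -6 := by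
  have hc : Continuous (fun x : ℝ => x^3-2*x^2-4*x+6) := by fun_prop
  obtain ⟨a, ⟨ha1, ha2⟩, ha⟩ := intermediate_value_Icc (by norm_num : (-2:ℝ) ≤ -1) hc.continuousOn
    (show (0:ℝ) ∈ _ by constructor <;> norm_num)
  obtain ⟨b, ⟨hb1, hb2⟩, hb⟩ := intermediate_value_Icc' (by norm_num : (1:ℝ) ≤ 2) hc.continuousOn
    (show (0:ℝ) ∈ _ by constructor <;> norm_num)
  obtain ⟨c, ⟨hc1, hc2⟩, hc⟩ := intermediate_value_Icc (by norm_num : (2:ℝ) ≤ 3) hc.continuousOn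
    (show (0:ℝ) ∈ _ by constructor <;> norm_num)
  simp only at ha hb hc
  have hbc : b - c ≠ 0 := by
    intro h
    have h1 : b = 2 := by linarith
    subst h1
    norm_num at hb
  have hab : a - b ≠ 0 := by intro h; linarith
  have hac : a - c ≠ 0 := by intro h; linarith
  have e1 : a^2+a*b+b^2-2*(a+b)-4 = 0 := by
    apply mul_left_cancel₀ hab; linear_combination ha - hb
  have e2 : a^2+a*c+c^2-2*(a+c)-4 = 0 := by
    apply mul_left_cancel₀ hac; linear_combination ha - hc
  have e3 : a+b+c = 2 := by
    apply mul_left_cancel₀ hbc; linear_combination e1 - e2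
  have e4 : a*b+b*c+c*a = -4 := by linear_combination (a+b)*e3 - e1
  refine ⟨a, b, c, by linarith, by linarith, by linarith, e3, e4, ?_⟩
  linear_combination ha - a^2*e3 + a*e4

open Polynomial in
/-- The adjacency matrix of `H₇` has exactly 4 positive eigenvalues and 3 negative
eigenvalues. -/
theorem H7_adjacency_signature (A : Matrix (Fin 7) (Fin 7) ℝ)
    (hdef : ∀ i j : Fin 7, A i j = if H7Edge i j then 1 else 0)
    (hA : A.IsHermitian) :
    Fintype.card {i : Fin 7 // 0 < hA.eigenvalues i} = 4 ∧
    Fintype.card {i : Fin 7 // hA.eigenvalues i < 0} = 3 := by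
  obtain ⟨a, b, c, ha, hb, hc, e1, e2, e3⟩ := H7_cubic
  obtain ⟨p, q, hp, hq, f1, f2⟩ : ∃ p q : ℝ, p < 0 ∧ 0 < q ∧ p + q = -1 ∧ p * q = -1 := by
    have h5 : √5 * √5 = (5:ℝ) := Real.mul_self_sqrt (by norm_num)
    have h1 : 1 < √(5:ℝ) := by rw [Real.lt_sqrt] <;> norm_num
    refine ⟨(-1-√5)/2, (-1+√5)/2, by linarith, by linarith, by ring, by linear_combination -h5/4⟩
  have hcp : A.charpoly = (({a,b,c,p,p,q,q} : Multiset ℝ).map (fun x => X - C x)).prod := by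
    rw [H7_cp A hdef]
    have g1 := congrArg (C : ℝ → ℝ[X]) e1
    have g2 := congrArg (C : ℝ → ℝ[X]) e2
    have g3 := congrArg (C : ℝ → ℝ[X]) e3
    have g4 := congrArg (C : ℝ → ℝ[X]) f1
    have g5 := congrArg (C : ℝ → ℝ[X]) f2
    simp only [map_add, map_mul, map_neg, map_one, map_ofNat] at g1 g2 g3 g4 g5
    have k1 : (X^3-2*X^2-4*X+6 : ℝ[X]) = (X - C a)*(X - C b)*(X - C c) := by
      linear_combination X^2*g1 - X*g2 + g3
    have k2 : (X^2+X-1 : ℝ[X]) = (X - C p)*(X - C q) := by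
      linear_combination X*g4 - g5
    rw [k1, k2]
    simp
    ring
  have hr := hA.roots_charpoly_eq_eigenvalues
  rw [hcp, Polynomial.roots_multiset_prod_X_sub_C] at hr
  have key : ∀ (P : ℝ → Prop) [DecidablePred P],
      Fintype.card {i : Fin 7 // P (hA.eigenvalues i)} = Multiset.countP P {a,b,c,p,p,q,q} := by
    intro P _
    rw [hr, Multiset.countP_map, Fintype.card_subtype]
    rfl
  constructor
  · rw [key (fun x => 0 < x)]
    simp [Multiset.countP_cons, ← Multiset.cons_zero, hb, hc, hq, ha.le, hp.le]
  · rw [key (fun x => x < 0)]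
    simp [Multiset.countP_cons, ← Multiset.cons_zero, hb.le, hc.le, hq.le, ha, hp]
end

section
/- Every 7×7 real symmetric matrix A with a_{ij} > 0 for ij ∈ E(H_7) and a_{ij} = 0 otherwise (where H_7 has edges {12, 13, 14, 23, 25, 36, 47, 57, 67}) has exactly 4 positive eigenvalues and 3 negative eigenvalues. -/
lemma H7_count (A : Matrix (Fin 7) (Fin 7) ℝ) (hA : A.IsHermitian)
    (hz : ∀ i j : Fin 7, (i = 3 ∨ i = 4 ∨ i = 5) → (j = 3 ∨ j = 4 ∨ j = 5) → A i j = 0)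
    (s : ℝ) : Fintype.card {i : Fin 7 // 0 < s * hA.eigenvalues i} ≤ 4 := by
  classical
  by_contra hcon
  push Not at hcon
  set U : Matrix (Fin 7) (Fin 7) ℝ := (hA.eigenvectorUnitary : Matrix (Fin 7) (Fin 7) ℝ) with hU
  let f : (Fin 7 → ℝ) →ₗ[ℝ] (({i : Fin 7 // ¬ (0 < s * hA.eigenvalues i)} → ℝ) × (Fin 4 → ℝ)) :=
    (LinearMap.funLeft ℝ ℝ Subtype.val).prod
      ((LinearMap.funLeft ℝ ℝ (![0, 1, 2, 6] : Fin 4 → Fin 7)).comp U.mulVecLin)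
  have hk : LinearMap.ker f ≠ ⊥ := by
    apply LinearMap.ker_ne_bot_of_finrank_lt
    have h := Fintype.card_subtype_compl (fun i : Fin 7 => 0 < s * hA.eigenvalues i)
    simp only [Module.finrank_prod, Module.finrank_fintype_fun_eq_card, Fintype.card_fin] at h ⊢
    omega
  obtain ⟨c, hc, hc0⟩ := (Submodule.ne_bot_iff _).1 hk
  rw [LinearMap.mem_ker] at hc
  have h1 : ∀ i, ¬ (0 < s * hA.eigenvalues i) → c i = 0 := fun i hi =>
    congrFun (congrArg Prod.fst hc) ⟨i, hi⟩
  have h2 : ∀ k : Fin 4, (U.mulVec c) ((![0, 1, 2, 6] : Fin 4 → Fin 7) k) = 0 := fun k =>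
    congrFun (congrArg Prod.snd hc) k
  set x := U.mulVec c with hx
  have x0 : x 0 = 0 := h2 0
  have x1 : x 1 = 0 := h2 1
  have x2 : x 2 = 0 := h2 2
  have x6 : x 6 = 0 := h2 3
  have e1 : x ⬝ᵥ A.mulVec x = 0 := by
    apply Finset.sum_eq_zero
    intro i _
    by_cases hi : i = 3 ∨ i = 4 ∨ i = 5
    · have : A.mulVec x i = 0 := by
        change ∑ j, A i j * x j = 0
        apply Finset.sum_eq_zero
        intro j _
        by_cases hj : j = 3 ∨ j = 4 ∨ j = 5
        · rw [hz i j hi hj, zero_mul]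
        · have : x j = 0 := by fin_cases j <;> simp_all
          rw [this, mul_zero]
      rw [this, mul_zero]
    · have : x i = 0 := by fin_cases i <;> simp_all
      rw [this, zero_mul]
  have hD : U.transpose * A * U = Matrix.diagonal hA.eigenvalues := by
    have := hA.conjStarAlgAut_star_eigenvectorUnitary
    simpa [Unitary.conjStarAlgAut_apply, Matrix.star_eq_conjTranspose, Function.comp_def] using this
  have e2 : x ⬝ᵥ A.mulVec x = ∑ i, hA.eigenvalues i * c i ^ 2 := by
    have : x ⬝ᵥ A.mulVec x = c ⬝ᵥ (U.transpose * A * U).mulVec c := by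
      rw [hx, ← Matrix.mulVec_mulVec, ← Matrix.mulVec_mulVec, Matrix.dotProduct_mulVec c,
        Matrix.vecMul_transpose]
    rw [this, hD]
    simp only [dotProduct, Matrix.mulVec_diagonal]
    exact Finset.sum_congr rfl fun i _ => by ring
  have e3 : 0 < ∑ i, s * hA.eigenvalues i * c i ^ 2 := by
    obtain ⟨k, hk⟩ := Function.ne_iff.1 hc0
    apply Finset.sum_pos'
    · intro i _
      by_cases hi : 0 < s * hA.eigenvalues i
      · positivity
      · simp [h1 i hi]
    · refine ⟨k, Finset.mem_univ _, ?_⟩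
      have hk' : c k ≠ 0 := hk
      have : 0 < s * hA.eigenvalues k := by
        by_contra h
        exact hk' (h1 k h)
      positivity
  have : ∑ i, s * hA.eigenvalues i * c i ^ 2 = s * ∑ i, hA.eigenvalues i * c i ^ 2 := by
    rw [Finset.mul_sum]
    exact Finset.sum_congr rfl fun i _ => by ring
  rw [this, ← e2, e1, mul_zero] at e3
  exact lt_irrefl _ e3

lemma H7_det_s6 (a b c d e f g h k : ℝ) :
    Matrix.det !![0,a,b,d,0,0,0; a,0,c,0,e,0,0; b,c,0,0,0,f,0; d,0,0,0,0,0,g;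
      0,e,0,0,0,0,h; 0,0,f,0,0,0,k; 0,0,0,g,h,k,0] =
    -2 * (a*d*g*h*e*f^2 + b*d*g*f*k*e^2 + c*e*h*f*k*d^2) := by
  simp [Matrix.det_succ_row_zero, Fin.sum_univ_succ, Fin.succAbove]
  ring

/-- Every `7 × 7` real symmetric matrix whose support is exactly the edge set of `H₇`
(positive entries on edges, zero elsewhere) has exactly 4 positive eigenvalues and
3 negative eigenvalues. -/
theorem H7_pattern_signature (A : Matrix (Fin 7) (Fin 7) ℝ) (hA : A.IsHermitian)
    (hpos : ∀ i j : Fin 7, H7Edge i j → 0 < A i j)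
    (hzero : ∀ i j : Fin 7, ¬ H7Edge i j → A i j = 0) :
    Fintype.card {i : Fin 7 // 0 < hA.eigenvalues i} = 4 ∧
    Fintype.card {i : Fin 7 // hA.eigenvalues i < 0} = 3 := by
  classical
  have hs : ∀ i j, A j i = A i j := fun i j => by simpa using hA.apply i j
  have z : ∀ i j : Fin 7, (i = 3 ∨ i = 4 ∨ i = 5) → (j = 3 ∨ j = 4 ∨ j = 5) → A i j = 0 := by
    intro i j hi hj
    apply hzero
    rcases hi with rfl | rfl | rfl <;> rcases hj with rfl | rfl | rfl <;> simp [H7Edge]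
  have hdet : A.det < 0 := by
    have hA' : A = !![0,A 0 1,A 0 2,A 0 3,0,0,0; A 0 1,0,A 1 2,0,A 1 4,0,0;
        A 0 2,A 1 2,0,0,0,A 2 5,0; A 0 3,0,0,0,0,0,A 3 6;
        0,A 1 4,0,0,0,0,A 4 6; 0,0,A 2 5,0,0,0,A 5 6; 0,0,0,A 3 6,A 4 6,A 5 6,0] := by
      ext i j
      fin_cases i <;> fin_cases j <;>
        first
        | rfl
        | exact hs _ _
        | exact hzero _ _ (by simp [H7Edge])
    rw [hA', H7_det_s6]
    have p1 := hpos 0 1 (by simp [H7Edge])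
    have p2 := hpos 0 2 (by simp [H7Edge])
    have p3 := hpos 0 3 (by simp [H7Edge])
    have p4 := hpos 1 2 (by simp [H7Edge])
    have p5 := hpos 1 4 (by simp [H7Edge])
    have p6 := hpos 2 5 (by simp [H7Edge])
    have p7 := hpos 3 6 (by simp [H7Edge])
    have p8 := hpos 4 6 (by simp [H7Edge])
    have p9 := hpos 5 6 (by simp [H7Edge])
    rw [neg_mul, neg_lt_zero]
    positivity
  have c1 := H7_count A hA z 1
  have c2 := H7_count A hA z (-1)
  simp only [one_mul, neg_mul, neg_pos] at c1 c2
  have hprod : A.det = ∏ i, hA.eigenvalues i := by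
    simpa using hA.det_eq_prod_eigenvalues
  have hne : ∀ i, hA.eigenvalues i ≠ 0 := by
    intro i hi
    rw [hprod, Finset.prod_eq_zero (Finset.mem_univ i) hi] at hdet
    exact lt_irrefl _ hdet
  have hsum : Fintype.card {i : Fin 7 // 0 < hA.eigenvalues i} +
      Fintype.card {i : Fin 7 // hA.eigenvalues i < 0} = 7 := by
    have h := Fintype.card_subtype_compl (fun i : Fin 7 => 0 < hA.eigenvalues i)
    have h' : Fintype.card {i : Fin 7 // ¬ 0 < hA.eigenvalues i} =
        Fintype.card {i : Fin 7 // hA.eigenvalues i < 0} :=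
      Fintype.card_congr (Equiv.subtypeEquivRight fun i =>
        ⟨fun hi => lt_of_le_of_ne (not_lt.1 hi) (hne i), fun hi => not_lt.2 hi.le⟩)
    have h3 := Fintype.card_subtype_le (fun i : Fin 7 => 0 < hA.eigenvalues i)
    simp only [Fintype.card_fin] at h h3
    omega
  have hodd : Fintype.card {i : Fin 7 // hA.eigenvalues i < 0} ≠ 4 := by
    intro h4
    have hfac : ∀ i, hA.eigenvalues i =
        (if hA.eigenvalues i < 0 then (-1 : ℝ) else 1) * |hA.eigenvalues i| := by
      intro i
      split_ifs with hi
      · rw [abs_of_neg hi]; ring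
      · rw [abs_of_nonneg (not_lt.1 hi)]; ring
    rw [Fintype.card_subtype] at h4
    rw [hprod, Finset.prod_congr rfl fun i _ => hfac i, Finset.prod_mul_distrib,
      Finset.prod_ite, Finset.prod_const, Finset.prod_const_one, h4] at hdet
    have : 0 ≤ ∏ i, |hA.eigenvalues i| := Finset.prod_nonneg fun i _ => abs_nonneg _
    norm_num at hdet
    linarith
  omega
end
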